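/- Let n = m² be a perfect square and define f_n : {0,1}^n → {0,1} by f_n = ⋁_{i=0}^{m−1} Parity_m(x_{m·i+1}, x_{m·i+2}, …, x_{m·i+m}), the disjunction of the parities of the m consecutive blocks of m variables. Then size^dc(f_n) = 3n − o(n); that is, there is a function h(n) = o(n) such that 3n − h(n) ≤ size^dc(f_n) ≤ 3n for all perfect squares n. -/

import Mathlib

/-!
Common definitions: Boolean circuits (with AND/OR/NOT gates of fan-in ≤ 2 and
dummy COPY gates used only for layering), nondeterministic circuits with guess
inputs, width via layerings, nondeterministic branching programs, and
U₂-circuits with their deterministic/nondeterministic circuit complexities.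
-/

/-- A node of a circuit with `n` actual inputs and `m` guess inputs.
Gate nodes refer to their predecessors by (strictly smaller) indices. -/
inductive CNode (n m : ℕ) : Type where
  | actual : Fin n → CNode n m
  | guess  : Fin m → CNode n m
  | const  : Bool → CNode n m
  | gand   : ℕ → ℕ → CNode n m
  | gor    : ℕ → ℕ → CNode n m
  | gnot   : ℕ → CNode n m
  | gcopy  : ℕ → CNode n m
deriving DecidableEq

namespace CNode

/-- The predecessor indices of a node. -/
def preds {n m : ℕ} : CNode n m → List ℕ
  | gand j k => [j, k]
  | gor j k  => [j, k]
  | gnot j   => [j]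
  | gcopy j  => [j]
  | _        => []

/-- Real gates (AND, OR, NOT); these are the gates counted in the size.
COPY gates are dummy gates inserted only to make the circuit layered. -/
def isGate {n m : ℕ} : CNode n m → Bool
  | gand _ _ => true
  | gor _ _  => true
  | gnot _   => true
  | _        => false

/-- Nodes occupying space in a layer (real gates and COPY gates);
these are counted in the width of a layer. -/
def isWide {n m : ℕ} : CNode n m → Bool
  | gand _ _ => true
  | gor _ _  => true
  | gnot _   => true
  | gcopy _  => true
  | _        => false

end CNode

/-- A (nondeterministic) Boolean circuit with `n` actual inputs and `m` guess
inputs: a DAG whose in-degree-0 nodes are labeled by actual inputs, guess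
inputs or constants, whose gates are AND/OR/NOT gates (plus dummy COPY gates),
with a designated output node.  Each guess input labels at most one node. -/
structure Circuit (n m : ℕ) : Type where
  N : ℕ
  node : Fin N → CNode n m
  output : Fin N
  wf : ∀ i : Fin N, ∀ j ∈ (node i).preds, j < (i : ℕ)
  guessOnce : ∀ g : Fin m,
    (Finset.univ.filter (fun i : Fin N => node i = CNode.guess g)).card ≤ 1

namespace Circuit

variable {n m : ℕ}

def nodeAt (c : Circuit n m) (i : ℕ) : CNode n m :=
  if h : i < c.N then c.node ⟨i, h⟩ else CNode.const false

/-- The Boolean value computed at node `i` on actual inputs `x` and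
guess inputs `y`. -/
def evalAux (c : Circuit n m) (x : Fin n → Bool) (y : Fin m → Bool) : ℕ → Bool
  | i =>
    match c.nodeAt i with
    | CNode.actual a => x a
    | CNode.guess g => y g
    | CNode.const b => b
    | CNode.gand j k =>
        (if _h : j < i then c.evalAux x y j else false) &&
        (if _h : k < i then c.evalAux x y k else false)
    | CNode.gor j k =>
        (if _h : j < i then c.evalAux x y j else false) ||
        (if _h : k < i then c.evalAux x y k else false)
    | CNode.gnot j => !(if _h : j < i then c.evalAux x y j else false)
    | CNode.gcopy j => (if _h : j < i then c.evalAux x y j else false)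
termination_by i => i

/-- The output value of the circuit. -/
def eval (c : Circuit n m) (x : Fin n → Bool) (y : Fin m → Bool) : Bool :=
  c.evalAux x y c.output

/-- A nondeterministic circuit computes `f` if for every actual input `x`,
`f x = 1` iff some assignment of the guess inputs makes the circuit output 1.
(For `m = 0` this is the usual notion for deterministic circuits.) -/
def Computes (c : Circuit n m) (f : (Fin n → Bool) → Bool) : Prop :=
  ∀ x : Fin n → Bool, f x = true ↔ ∃ y : Fin m → Bool, c.eval x y = true

/-- The size of a circuit: the number of (non-COPY) gates. -/
def size (c : Circuit n m) : ℕ :=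
  (Finset.univ.filter (fun i : Fin c.N => (c.node i).isGate = true)).card

/-- `ℓ` is a layering of the circuit: every wire goes between adjacent layers. -/
def IsLayering (c : Circuit n m) (ℓ : Fin c.N → ℕ) : Prop :=
  ∀ i : Fin c.N, ∀ j ∈ (c.node i).preds, ∀ hj : j < c.N, ℓ ⟨j, hj⟩ + 1 = ℓ i

/-- The circuit has width at most `w`: there is a layering in which every layer
contains at most `w` gates (real gates and COPY gates). -/
def HasWidth (c : Circuit n m) (w : ℕ) : Prop :=
  ∃ ℓ : Fin c.N → ℕ, c.IsLayering ℓ ∧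
    ∀ t : ℕ,
      (Finset.univ.filter
        (fun i : Fin c.N => ℓ i = t ∧ (c.node i).isWide = true)).card ≤ w

/-- The circuit is read-`k`-times: every actual input labels at most `k` nodes. -/
def ReadK (c : Circuit n m) (k : ℕ) : Prop :=
  ∀ a : Fin n,
    (Finset.univ.filter (fun i : Fin c.N => c.node i = CNode.actual a)).card ≤ k

/-- The maximal number of (non-COPY) gates on a path ending at node `i`. -/
def depthAux (c : Circuit n m) : ℕ → ℕ
  | i =>
    match c.nodeAt i with
    | CNode.actual _ => 0
    | CNode.guess _ => 0
    | CNode.const _ => 0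
    | CNode.gand j k =>
        max (if _h : j < i then c.depthAux j else 0)
            (if _h : k < i then c.depthAux k else 0) + 1
    | CNode.gor j k =>
        max (if _h : j < i then c.depthAux j else 0)
            (if _h : k < i then c.depthAux k else 0) + 1
    | CNode.gnot j => (if _h : j < i then c.depthAux j else 0) + 1
    | CNode.gcopy j => (if _h : j < i then c.depthAux j else 0)
termination_by i => i

/-- The depth of a circuit: the maximal number of gates on a directed path
from an input to the output. -/
def depth (c : Circuit n m) : ℕ := c.depthAux c.output

end Circuit

/-- A nondeterministic branching program on `n` Boolean variables: a DAG whose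
inner nodes are labeled by variables with outgoing edges labeled 0 or 1 (edges
go to strictly larger indices), whose sinks are labeled 0 or 1, with a
designated start node. -/
structure NBP (n : ℕ) : Type where
  N : ℕ
  label : Fin N → Fin n ⊕ Bool
  edges : Fin N → Bool → Finset (Fin N)
  start : Fin N
  wf : ∀ i : Fin N, ∀ b : Bool, ∀ j ∈ edges i b,
        (i : ℕ) < (j : ℕ) ∧ (label i).isLeft

namespace NBP

variable {n : ℕ}

/-- The size of a branching program: the number of its nodes. -/
def size (B : NBP n) : ℕ := B.N

/-- On input `x`, some path from node `i` consistent with `x` reaches a 1-sink. -/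
def AccFrom (B : NBP n) (x : Fin n → Bool) : Fin B.N → Prop
  | i =>
    match B.label i with
    | Sum.inr b => b = true
    | Sum.inl v => ∃ j ∈ B.edges i (x v), ∃ _h : (i : ℕ) < (j : ℕ), B.AccFrom x j
termination_by i => B.N - (i : ℕ)
decreasing_by
  have := j.isLt
  omega

/-- A nondeterministic branching program computes `f` if for every `x`,
`f x = 1` iff at least one path consistent with `x` leads to a 1-sink. -/
def Computes (B : NBP n) (f : (Fin n → Bool) → Bool) : Prop :=
  ∀ x : Fin n → Bool, f x = true ↔ B.AccFrom x B.start

/-- A (syntactic) path in the underlying graph of the branching program. -/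
def IsPath (B : NBP n) : List (Fin B.N) → Prop
  | [] => True
  | [_] => True
  | i :: j :: p => (∃ b : Bool, j ∈ B.edges i b) ∧ B.IsPath (j :: p)

/-- The branching program is syntactic read-`k`-times: every variable appears
at most `k` times on each path. -/
def SyntacticReadK (B : NBP n) (k : ℕ) : Prop :=
  ∀ p : List (Fin B.N), B.IsPath p → ∀ v : Fin n,
    (p.countP fun i => decide (B.label i = Sum.inl v)) ≤ k

end NBP

/-- A node of a `U₂`-circuit.  A gate `gate a b c j k` computes
`((vⱼ ⊕ a) ∧ (v_k ⊕ b)) ⊕ c` from the values `vⱼ, v_k` of its two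
predecessors; these are exactly the Boolean functions in `U₂`
(all two-variable Boolean functions except XOR and its complement). -/
inductive U2Node (n m : ℕ) : Type where
  | actual : Fin n → U2Node n m
  | guess  : Fin m → U2Node n m
  | const  : Bool → U2Node n m
  | gate   : Bool → Bool → Bool → ℕ → ℕ → U2Node n m
deriving DecidableEq

namespace U2Node

def isGate {n m : ℕ} : U2Node n m → Bool
  | gate _ _ _ _ _ => true
  | _ => false

end U2Node

/-- A (nondeterministic) `U₂`-circuit with `n` actual inputs and `m` guess
inputs: every gate has fan-in 2 and is labeled by a function in `U₂`. -/
structure U2Circuit (n m : ℕ) : Type where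
  N : ℕ
  node : Fin N → U2Node n m
  output : Fin N
  wf : ∀ i : Fin N, ∀ a b c j k,
        node i = U2Node.gate a b c j k → j < (i : ℕ) ∧ k < (i : ℕ)

namespace U2Circuit

variable {n m : ℕ}

def nodeAt (c : U2Circuit n m) (i : ℕ) : U2Node n m :=
  if h : i < c.N then c.node ⟨i, h⟩ else U2Node.const false

def evalAux (c : U2Circuit n m) (x : Fin n → Bool) (y : Fin m → Bool) : ℕ → Bool
  | i =>
    match c.nodeAt i with
    | U2Node.actual a => x a
    | U2Node.guess g => y g
    | U2Node.const b => b
    | U2Node.gate a b cc j k =>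
        xor
          ((xor (if _h : j < i then c.evalAux x y j else false) a) &&
           (xor (if _h : k < i then c.evalAux x y k else false) b))
          cc
termination_by i => i

def eval (c : U2Circuit n m) (x : Fin n → Bool) (y : Fin m → Bool) : Bool :=
  c.evalAux x y c.output

/-- A nondeterministic `U₂`-circuit computes `f` if for every actual input `x`,
`f x = 1` iff some assignment of the guess inputs makes the circuit output 1. -/
def Computes (c : U2Circuit n m) (f : (Fin n → Bool) → Bool) : Prop :=
  ∀ x : Fin n → Bool, f x = true ↔ ∃ y : Fin m → Bool, c.eval x y = true

/-- The size of a `U₂`-circuit: the number of its gates. -/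
def size (c : U2Circuit n m) : ℕ :=
  (Finset.univ.filter (fun i : Fin c.N => (c.node i).isGate = true)).card

end U2Circuit

/-- `size^dc f`: the size of the smallest deterministic `U₂`-circuit
computing `f`. -/
noncomputable def sizeDC {n : ℕ} (f : (Fin n → Bool) → Bool) : ℕ :=
  sInf {s : ℕ | ∃ c : U2Circuit n 0, c.Computes f ∧ c.size = s}

/-- `size^ndc f`: the size of the smallest nondeterministic `U₂`-circuit
computing `f`. -/
noncomputable def sizeNDC {n : ℕ} (f : (Fin n → Bool) → Bool) : ℕ :=
  sInf {s : ℕ | ∃ m : ℕ, ∃ c : U2Circuit n m, c.Computes f ∧ c.size = s}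

/-- The parity function: `parityFun n x = 1` iff `Σ xᵢ ≡ 1 (mod 2)`. -/
def parityFun (n : ℕ) : (Fin n → Bool) → Bool :=
  fun x => decide ((∑ i : Fin n, (x i).toNat) % 2 = 1)

theorem blockIdx_lt {m : ℕ} (i j : Fin m) : m * (i : ℕ) + (j : ℕ) < m * m := by
  have hi := i.isLt
  have hj := j.isLt
  nlinarith

/-- The disjunction of the parities of the `m` consecutive blocks of `m`
variables:
`⋁_{i=0}^{m-1} Parity_m (x_{m·i+1}, …, x_{m·i+m})` on `n = m²` variables. -/
def blockParityOr (m : ℕ) : (Fin (m * m) → Bool) → Bool :=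
  fun x => decide (∃ i : Fin m,
    parityFun m (fun j => x ⟨m * (i : ℕ) + (j : ℕ), blockIdx_lt i j⟩) = true)

/-! ### Gate elimination for AND-circuits with free negations -/

/-- A signal of a circuit: a constant, a variable or the value of a gate. -/
inductive Signal (V : Type*) : Type _ where
  | const : Bool → Signal V
  | var : V → Signal V
  | gate : ℕ → Signal V

/-- A possibly negated signal. -/
structure SignedSignal (V : Type*) : Type _ where
  src : Signal V
  neg : Bool

/-- The value of a signal when `val` gives the values of the gates. -/
def Signal.eval {V : Type*} (val : ℕ → (V → Bool) → Bool) (x : V → Bool) : Signal V → Bool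
  | .const b => b
  | .var v => x v
  | .gate j => val j x

/-- The value of a possibly negated signal. -/
def SignedSignal.eval {V : Type*} (val : ℕ → (V → Bool) → Bool) (x : V → Bool)
    (u : SignedSignal V) : Bool :=
  xor (u.src.eval val x) u.neg

/-- Replace the gate `g` by the signal `t`. -/
def SignedSignal.subst {V : Type*} (u : SignedSignal V) (g : ℕ) (t : SignedSignal V) :
    SignedSignal V :=
  match u.src with
  | .gate j => if j = g then ⟨t.src, xor t.neg u.neg⟩ else u
  | _ => u

/-- An assignment with one coordinate flipped. -/
def flipAt {V : Type*} [DecidableEq V] (i : V) (x : V → Bool) : V → Bool :=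
  Function.update x i (!x i)

/-- A circuit of AND gates with free negations.  The values of the gates are part of the data, so
that a circuit may be restricted to fewer assignments without being changed. -/
structure AndCircuit (V : Type*) : Type _ where
  gates : Finset ℕ
  pred : ℕ → Bool → SignedSignal V
  val : ℕ → (V → Bool) → Bool
  out : SignedSignal V

namespace AndCircuit

variable {V : Type*}

/-- The circuit is well formed and computes `f` on the assignments in `A`. -/
structure ComputesOn (C : AndCircuit V) (A : Set (V → Bool)) (f : (V → Bool) → Bool) : Prop where
  val_eq : ∀ i ∈ C.gates, ∀ x ∈ A,
    C.val i x = ((C.pred i false).eval C.val x && (C.pred i true).eval C.val x)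
  pred_lt : ∀ i ∈ C.gates, ∀ s j, (C.pred i s).src = .gate j → j ∈ C.gates ∧ j < i
  out_mem : ∀ j, C.out.src = .gate j → j ∈ C.gates
  out_eq : ∀ x ∈ A, f x = C.out.eval C.val x

namespace ComputesOn

variable {C : AndCircuit V} {A : Set (V → Bool)} {f : (V → Bool) → Bool}

theorem mono {B : Set (V → Bool)} (hC : C.ComputesOn A f) (h : B ⊆ A) : C.ComputesOn B f :=
  ⟨fun i hi x hx => hC.val_eq i hi x (h hx), hC.pred_lt, hC.out_mem,
    fun x hx => hC.out_eq x (h hx)⟩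

theorem val_eq_side (hC : C.ComputesOn A f) {i : ℕ} (hi : i ∈ C.gates) (s : Bool)
    {x : V → Bool} (hx : x ∈ A) :
    C.val i x = ((C.pred i s).eval C.val x && (C.pred i (!s)).eval C.val x) := by
  rw [hC.val_eq i hi x hx]
  cases s
  · rfl
  · exact Bool.and_comm _ _

theorem eval_subst {g : ℕ} {t : SignedSignal V} {val : ℕ → (V → Bool) → Bool} {x : V → Bool}
    (ht : val g x = t.eval val x) (u : SignedSignal V) :
    (u.subst g t).eval val x = u.eval val x := by
  rcases u with ⟨_ | _ | j, e⟩
  · rfl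
  · rfl
  · by_cases hj : j = g
    · subst hj
      simp [SignedSignal.subst, SignedSignal.eval, Signal.eval] at ht ⊢
      rw [ht, Bool.xor_assoc]
    · simp [SignedSignal.subst, hj]

theorem subst_src {g : ℕ} {t u : SignedSignal V} {j : ℕ} (h : (u.subst g t).src = .gate j) :
    (u.src = .gate g ∧ t.src = .gate j) ∨ (u.src = .gate j ∧ j ≠ g) := by
  rcases u with ⟨_ | _ | k, e⟩
  · simp [SignedSignal.subst] at h
  · simp [SignedSignal.subst] at h
  · by_cases hk : k = g
    · left
      simpa [SignedSignal.subst, hk] using h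
    · right
      simp only [SignedSignal.subst, hk, if_false] at h
      refine ⟨h, ?_⟩
      rintro rfl
      simp_all

/-- A gate that computes a signal available before it can be removed. -/
theorem erase_redundant (hC : C.ComputesOn A f) {g : ℕ} (t : SignedSignal V)
    (ht : ∀ x ∈ A, C.val g x = t.eval C.val x)
    (htg : ∀ j, t.src = .gate j → j ∈ C.gates ∧ j < g) :
    ComputesOn ⟨C.gates.erase g, fun i s => (C.pred i s).subst g t, C.val, C.out.subst g t⟩ A f where
  val_eq i hi x hx := by
    simp only [eval_subst (ht x hx)]
    exact hC.val_eq i (Finset.mem_of_mem_erase hi) x hx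
  pred_lt i hi s j h := by
    have hi' := Finset.mem_of_mem_erase hi
    rcases subst_src h with ⟨h1, h2⟩ | ⟨h1, h2⟩
    · have := hC.pred_lt i hi' s g h1
      have := htg j h2
      exact ⟨Finset.mem_erase.2 ⟨by omega, this.1⟩, by omega⟩
    · have := hC.pred_lt i hi' s j h1
      exact ⟨Finset.mem_erase.2 ⟨h2, this.1⟩, this.2⟩
  out_mem j h := by
    rcases subst_src h with ⟨h1, h2⟩ | ⟨h1, h2⟩
    · have := htg j h2
      exact Finset.mem_erase.2 ⟨by omega, this.1⟩
    · exact Finset.mem_erase.2 ⟨h2, hC.out_mem j h1⟩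
  out_eq x hx := by
    simp only [eval_subst (ht x hx)]
    exact hC.out_eq x hx

/-- A gate that is not used can be removed. -/
theorem erase_unused (hC : C.ComputesOn A f) {g : ℕ}
    (hg : ∀ h ∈ C.gates, ∀ s, (C.pred h s).src ≠ .gate g) (ho : C.out.src ≠ .gate g) :
    ComputesOn ⟨C.gates.erase g, C.pred, C.val, C.out⟩ A f where
  val_eq i hi := hC.val_eq i (Finset.mem_of_mem_erase hi)
  pred_lt i hi s j h := by
    have hi' := Finset.mem_of_mem_erase hi
    refine ⟨Finset.mem_erase.2 ⟨?_, (hC.pred_lt i hi' s j h).1⟩, (hC.pred_lt i hi' s j h).2⟩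
    rintro rfl
    exact hg i hi' s h
  out_mem j h := by
    refine Finset.mem_erase.2 ⟨?_, hC.out_mem j h⟩
    rintro rfl
    exact ho h
  out_eq := hC.out_eq

/-- All gates with a constant predecessor can be removed. -/
theorem exists_sdiff {T : Finset ℕ} (hC : C.ComputesOn A f) (hT : T ⊆ C.gates)
    (hconst : ∀ h ∈ T, ∃ s b, ∀ x ∈ A, (C.pred h s).eval C.val x = b) :
    ∃ C' : AndCircuit V, C'.ComputesOn A f ∧ C'.gates = C.gates \ T := by
  induction T using Finset.induction_on generalizing C with
  | empty => exact ⟨C, hC, by simp⟩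
  | insert g T hgT ih =>
    have hg : g ∈ C.gates := hT (Finset.mem_insert_self _ _)
    obtain ⟨t, ht, htg⟩ : ∃ t : SignedSignal V, (∀ x ∈ A, C.val g x = t.eval C.val x) ∧
        ∀ j, t.src = .gate j → j ∈ C.gates ∧ j < g := by
      obtain ⟨s, b, hb⟩ := hconst g (Finset.mem_insert_self _ _)
      cases b
      · refine ⟨⟨.const false, false⟩, fun x hx => ?_, by simp⟩
        rw [hC.val_eq_side hg s hx, hb x hx]
        rfl
      · refine ⟨C.pred g (!s), fun x hx => ?_, hC.pred_lt g hg _⟩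
        rw [hC.val_eq_side hg s hx, hb x hx, Bool.true_and]
    obtain ⟨C', hC', hgates⟩ := ih (hC.erase_redundant t ht htg)
      (fun h hh => Finset.mem_erase.2
        ⟨fun e => hgT (e ▸ hh), hT (Finset.mem_insert_of_mem hh)⟩)
      (fun h hh => by
        obtain ⟨s, b, hb⟩ := hconst h (Finset.mem_insert_of_mem hh)
        exact ⟨s, b, fun x hx => by rw [← hb x hx]; exact eval_subst (ht x hx) _⟩)
    refine ⟨C', hC', ?_⟩
    rw [hgates]
    ext k
    simp only [Finset.mem_sdiff, Finset.mem_erase, Finset.mem_insert]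
    tauto

end ComputesOn

/-- If `f` depends on every live variable even after another live variable is fixed arbitrarily,
then some live variable can be fixed so that three gates disappear. -/
theorem exists_restrict_three [DecidableEq V] {A : Set (V → Bool)} {f : (V → Bool) → Bool}
    {D : Finset V} (hflip : ∀ x ∈ A, ∀ i ∈ D, flipAt i x ∈ A)
    (hdead : ∀ v ∉ D, ∃ b, ∀ x ∈ A, x v = b)
    (hdep : ∀ i ∈ D, ∀ j ∈ D, i ≠ j → ∀ c, ∃ x ∈ A, x j = c ∧ f (flipAt i x) ≠ f x)
    (hD : ∃ i ∈ D, ∃ j ∈ D, i ≠ j) :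
    ∀ (k : ℕ) (C : AndCircuit V), C.gates.card = k → C.ComputesOn A f →
      ∃ i ∈ D, ∃ c, ∃ C' : AndCircuit V, C'.ComputesOn {x ∈ A | x i = c} f ∧
        C'.gates.card + 3 ≤ C.gates.card := by
  have flip_ne {i j : V} (h : j ≠ i) (x : V → Bool) : flipAt i x j = x j := by
    simp [flipAt, h]
  have out_not_const (C : AndCircuit V) (hC : C.ComputesOn A f) (i : V) (hi : i ∈ D) (c b : Bool)
      (h : ∀ x ∈ A, x i = c → C.out.eval C.val x = b) : False := by
    obtain ⟨j, hj, hji⟩ : ∃ j ∈ D, j ≠ i := by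
      obtain ⟨p, hp, q, hq, hpq⟩ := hD
      by_cases hpi : p = i
      · exact ⟨q, hq, fun e => hpq (hpi.trans e.symm)⟩
      · exact ⟨p, hp, hpi⟩
    obtain ⟨x, hx, hxi, hne⟩ := hdep j hj i hi hji c
    apply hne
    rw [hC.out_eq x hx, hC.out_eq _ (hflip x hx j hj), h x hx hxi,
      h _ (hflip x hx j hj) (by rw [flip_ne hji.symm, hxi])]
  have out_not_var (C : AndCircuit V) (hC : C.ComputesOn A f) (v : V)
      (h : C.out.src = .var v) : False := by
    obtain ⟨i, hi, j, hj, hiv, hij⟩ : ∃ i ∈ D, ∃ j ∈ D, v ≠ i ∧ i ≠ j := by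
      obtain ⟨p, hp, q, hq, hpq⟩ := hD
      by_cases hpv : v = p
      · exact ⟨q, hq, p, hp, fun e => hpq (hpv.symm.trans e), hpq.symm⟩
      · exact ⟨p, hp, q, hq, hpv, hpq⟩
    obtain ⟨x, hx, -, hne⟩ := hdep i hi j hj hij true
    apply hne
    rw [hC.out_eq x hx, hC.out_eq _ (hflip x hx i hi)]
    simp [SignedSignal.eval, h, Signal.eval, flip_ne hiv]
  intro k
  induction k using Nat.strong_induction_on with
  | _ k ih =>
  intro C hk hC
  have descend (g : ℕ) (hg : g ∈ C.gates) (C₁ : AndCircuit V) (hC₁ : C₁.ComputesOn A f)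
      (hgates : C₁.gates = C.gates.erase g) :
      ∃ i ∈ D, ∃ c, ∃ C' : AndCircuit V, C'.ComputesOn {x ∈ A | x i = c} f ∧
        C'.gates.card + 3 ≤ C.gates.card := by
    have hcard : C₁.gates.card + 1 = C.gates.card := by
      rw [hgates, Finset.card_erase_add_one hg]
    obtain ⟨i, hi, c, C', hC', hle⟩ := ih C₁.gates.card (by omega) C₁ rfl hC₁
    exact ⟨i, hi, c, C', hC', by omega⟩
  by_cases hunused : ∃ g ∈ C.gates, (∀ h ∈ C.gates, ∀ s, (C.pred h s).src ≠ .gate g) ∧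
      C.out.src ≠ .gate g
  · obtain ⟨g, hg, hg₁, hg₂⟩ := hunused
    exact descend g hg _ (hC.erase_unused hg₁ hg₂) rfl
  have used : ∀ g ∈ C.gates, C.out.src ≠ .gate g → ∃ h ∈ C.gates, ∃ s,
      (C.pred h s).src = .gate g := by
    intro g hg ho
    by_contra hcon
    push Not at hcon
    exact hunused ⟨g, hg, hcon, ho⟩
  have hne : C.gates.Nonempty := by
    by_contra hempty
    rw [Finset.not_nonempty_iff_eq_empty] at hempty
    rcases hsrc : C.out.src with b | v | j
    · obtain ⟨i, hi, -⟩ := hD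
      refine out_not_const C hC i hi true (xor b C.out.neg) fun x _ _ => ?_
      simp [SignedSignal.eval, hsrc, Signal.eval]
    · exact out_not_var C hC v hsrc
    · have := hC.out_mem j hsrc
      simp [hempty] at this
  set g := C.gates.min' hne with hgdef
  have hg : g ∈ C.gates := C.gates.min'_mem hne
  have hgmin : ∀ s j, (C.pred g s).src ≠ .gate j := fun s j h =>
    absurd (C.gates.min'_le j (hC.pred_lt g hg s j h).1)
      (not_le.2 (hC.pred_lt g hg s j h).2)
  by_cases hgconst : ∃ s b, ∀ x ∈ A, (C.pred g s).eval C.val x = b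
  · obtain ⟨C₁, hC₁, hgates⟩ := hC.exists_sdiff (T := {g}) (by simpa using hg)
      (by simpa using hgconst)
    exact descend g hg C₁ hC₁ (by rw [hgates, Finset.sdiff_singleton_eq_erase])
  have live : ∀ s, ∃ i ∈ D, (C.pred g s).src = .var i := by
    intro s
    rcases hsrc : (C.pred g s).src with b | v | j
    · exact absurd ⟨s, xor b (C.pred g s).neg, fun x _ => by
        simp [SignedSignal.eval, hsrc, Signal.eval]⟩ hgconst
    · refine ⟨v, ?_, rfl⟩
      by_contra hv
      obtain ⟨b, hb⟩ := hdead v hv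
      exact hgconst ⟨s, xor b (C.pred g s).neg, fun x hx => by
        simp [SignedSignal.eval, hsrc, Signal.eval, hb x hx]⟩
    · exact absurd hsrc (hgmin s j)
  obtain ⟨i, hi, hgi⟩ := live false
  obtain ⟨j, hj, hgj⟩ := live true
  by_cases hij : i = j
  · subst hij
    by_cases hneg : (C.pred g false).neg = (C.pred g true).neg
    · refine descend g hg _ (hC.erase_redundant (C.pred g false) (fun x hx => ?_)
        (hC.pred_lt g hg _)) rfl
      rw [hC.val_eq g hg x hx]
      simp [SignedSignal.eval, hgi, hgj, hneg]
    · refine descend g hg _ (hC.erase_redundant ⟨.const false, false⟩ (fun x hx => ?_)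
        (by simp)) rfl
      rw [hC.val_eq g hg x hx]
      revert hneg
      simp only [SignedSignal.eval, hgi, hgj, Signal.eval]
      cases x i <;> cases (C.pred g false).neg <;> cases (C.pred g true).neg <;> simp
  -- The variable `i` feeds a second gate: otherwise fixing `j` makes `f` independent of `i`.
  obtain ⟨g', hg', hg'g, s', hs'⟩ : ∃ g' ∈ C.gates, g' ≠ g ∧ ∃ s, (C.pred g' s).src = .var i := by
    by_contra hcon
    push Not at hcon
    obtain ⟨x, hx, hxj, hfx⟩ := hdep i hi j hj hij (C.pred g true).neg
    have hx' := hflip x hx i hi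
    have hval : ∀ h, h ∈ C.gates → C.val h (flipAt i x) = C.val h x := by
      intro h
      induction h using Nat.strong_induction_on with
      | _ h ihh =>
      intro hh
      rw [hC.val_eq h hh _ hx', hC.val_eq h hh x hx]
      by_cases hhg : h = g
      · rw [hhg]
        simp [SignedSignal.eval, hgj, Signal.eval, flip_ne (Ne.symm hij), hxj]
      · have hside : ∀ s, (C.pred h s).eval C.val (flipAt i x) = (C.pred h s).eval C.val x := by
          intro s
          unfold SignedSignal.eval
          congr 1
          rcases hsrc : (C.pred h s).src with b | v | l
          · rfl
          · refine flip_ne ?_ x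
            rintro rfl
            exact hcon h hh hhg s hsrc
          · have := hC.pred_lt h hh s l hsrc
            exact ihh l this.2 this.1
        rw [hside, hside]
    apply hfx
    rw [hC.out_eq x hx, hC.out_eq _ hx']
    unfold SignedSignal.eval
    congr 1
    rcases hsrc : C.out.src with b | v | l
    · rfl
    · exact (out_not_var C hC v hsrc).elim
    · exact hval l (hC.out_mem l hsrc)
  -- Fix `i` so that `g` becomes constant.
  set c := (C.pred g false).neg with hc
  have hCr : C.ComputesOn {x ∈ A | x i = c} f := hC.mono fun x hx => hx.1
  have const_i : ∀ h s, (C.pred h s).src = .var i →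
      ∃ b, ∀ x ∈ {x ∈ A | x i = c}, (C.pred h s).eval C.val x = b := fun h s hs =>
    ⟨xor c (C.pred h s).neg, fun x hx => by
      simp [SignedSignal.eval, hs, Signal.eval, hx.2]⟩
  have const_gate : ∀ l b, (∀ x ∈ {x ∈ A | x i = c}, C.val l x = b) →
      ∀ h s, (C.pred h s).src = .gate l →
      ∃ b, ∀ x ∈ {x ∈ A | x i = c}, (C.pred h s).eval C.val x = b := fun l b hl h s hs =>
    ⟨xor b (C.pred h s).neg, fun x hx => by
      simp [SignedSignal.eval, hs, Signal.eval, hl x hx]⟩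
  have not_out : ∀ l b, (∀ x ∈ {x ∈ A | x i = c}, C.val l x = b) → C.out.src ≠ .gate l :=
    fun l b hl hs => out_not_const C hC i hi c (xor b C.out.neg) fun x hx hxi => by
      simp [SignedSignal.eval, hs, Signal.eval, hl x ⟨hx, hxi⟩]
  have hgval : ∀ x ∈ {x ∈ A | x i = c}, C.val g x = false := fun x hx => by
    rw [hC.val_eq g hg x hx.1]
    simp [SignedSignal.eval, hgi, Signal.eval, hx.2, hc]
  have conclude : ∀ h ∈ C.gates, h ≠ g → h ≠ g' →
      (∃ s b, ∀ x ∈ {x ∈ A | x i = c}, (C.pred h s).eval C.val x = b) →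
      ∃ i ∈ D, ∃ c, ∃ C' : AndCircuit V, C'.ComputesOn {x ∈ A | x i = c} f ∧
        C'.gates.card + 3 ≤ C.gates.card := by
    intro h hh hhg hhg' hconst
    have hsub : ({h, g, g'} : Finset ℕ) ⊆ C.gates := by
      intro l hl
      simp only [Finset.mem_insert, Finset.mem_singleton] at hl
      rcases hl with rfl | rfl | rfl <;> assumption
    obtain ⟨C', hC', hgates⟩ := hCr.exists_sdiff hsub (by
      intro l hl
      simp only [Finset.mem_insert, Finset.mem_singleton] at hl
      rcases hl with rfl | rfl | rfl
      · exact hconst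
      · exact ⟨false, const_i _ _ hgi⟩
      · exact ⟨s', const_i _ _ hs'⟩)
    refine ⟨i, hi, c, C', hC', ?_⟩
    have hthree : ({h, g, g'} : Finset ℕ).card = 3 :=
      Finset.card_eq_three.2 ⟨h, g, g', hhg, hhg', hg'g.symm, rfl⟩
    have := Finset.card_sdiff_add_card_eq_card hsub
    rw [hgates]
    omega
  obtain ⟨h, hh, s, hs⟩ := used g hg (not_out g false hgval)
  have hhg : h ≠ g := by
    rintro rfl
    exact hgmin s _ hs
  by_cases hhg' : h = g'
  · subst hhg'
    have hss : s' = !s := by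
      by_contra hcon
      have : s' = s := by revert hcon; cases s <;> cases s' <;> simp
      rw [this, hs] at hs'
      cases hs'
    subst hss
    obtain ⟨b₁, hb₁⟩ := const_gate g false hgval h s hs
    obtain ⟨b₂, hb₂⟩ := const_i h _ hs'
    have hhval : ∀ x ∈ {x ∈ A | x i = c}, C.val h x = (b₁ && b₂) := fun x hx => by
      rw [hC.val_eq_side hh s hx.1, hb₁ x hx, hb₂ x hx]
    obtain ⟨l, hl, t, ht⟩ := used h hh (not_out h _ hhval)
    refine conclude l hl ?_ ?_ ⟨t, const_gate h _ hhval l t ht⟩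
    · rintro rfl
      exact hgmin t _ ht
    · rintro rfl
      exact lt_irrefl _ (hC.pred_lt l hl t l ht).2
  · exact conclude h hh hhg hhg' ⟨s, const_gate g false hgval h s hs⟩

end AndCircuit

/-- The parity of the true variables in a block. -/
def blockSum {V ι : Type*} [Fintype V] [DecidableEq ι] (blk : V → ι) (b : ι) (x : V → Bool) :
    ZMod 2 :=
  ∑ v, if blk v = b ∧ x v = true then 1 else 0

theorem blockSum_flipAt {V ι : Type*} [Fintype V] [DecidableEq V] [DecidableEq ι] (blk : V → ι)
    (b : ι) (x : V → Bool) (i : V) :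
    blockSum blk b (flipAt i x) = blockSum blk b x + if blk i = b then 1 else 0 := by
  have hite : (if blk i = b then (1 : ZMod 2) else 0) =
      ∑ v, if v = i then (if blk i = b then (1 : ZMod 2) else 0) else 0 := by
    simp
  rw [hite, blockSum, blockSum, ← Finset.sum_add_distrib]
  refine Finset.sum_congr rfl fun v _ => ?_
  have h2 : (1 : ZMod 2) + 1 = 0 := by decide
  by_cases hv : v = i
  · subst hv
    by_cases hb : blk v = b <;> cases hx : x v <;> simp [flipAt, hb, hx, h2]
  · simp [flipAt, hv]

/-- An AND-circuit for the disjunction of the block parities on a subcube has at least three gates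
for every live variable, apart from one variable in each block. -/
theorem three_mul_sum_le_card_gates {V ι : Type*} [Fintype V] [DecidableEq V] [Fintype ι]
    [DecidableEq ι] (blk : V → ι) (f : (V → Bool) → Bool)
    (hf : ∀ x, f x = false ↔ ∀ b, blockSum blk b x = 0) (D : Finset V) :
    ∀ (ρ : V → Bool) (C : AndCircuit V), (∀ b, blockSum blk b ρ = 0) →
      (∀ b, (D.filter (blk · = b)).card ≠ 1) → C.ComputesOn {x | ∀ v ∉ D, x v = ρ v} f →
      3 * ∑ b, ((D.filter (blk · = b)).card - 1) ≤ C.gates.card := by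
  induction D using Finset.strongInduction with
  | _ D ih =>
  intro ρ C hρ hD hC
  have partner : ∀ i ∈ D, ∃ k ∈ D, k ≠ i ∧ blk k = blk i := by
    intro i hi
    have hmem : i ∈ D.filter (blk · = blk i) := by simp [hi]
    have hpos : 0 < (D.filter (blk · = blk i)).card := Finset.card_pos.2 ⟨i, hmem⟩
    have := hD (blk i)
    obtain ⟨k, hk, hki⟩ : ∃ k ∈ D.filter (blk · = blk i), k ≠ i :=
      Finset.exists_mem_ne (by omega) i
    simp only [Finset.mem_filter] at hk
    exact ⟨k, hk.1, hki, hk.2⟩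
  have flip_mem : ∀ x ∈ {x : V → Bool | ∀ v ∉ D, x v = ρ v}, ∀ i ∈ D,
      flipAt i x ∈ {x : V → Bool | ∀ v ∉ D, x v = ρ v} := by
    intro x hx i hi v hv
    have : v ≠ i := fun e => hv (e ▸ hi)
    simpa [flipAt, this] using hx v hv
  have even_point : ∀ i ∈ D, ∀ c, ∃ x : V → Bool, (∀ v ∉ D, x v = ρ v) ∧ x i = c ∧
      ∀ b, blockSum blk b x = 0 := by
    intro i hi c
    by_cases hc : ρ i = c
    · exact ⟨ρ, fun _ _ => rfl, hc, hρ⟩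
    · obtain ⟨k, hk, hki, hblk⟩ := partner i hi
      refine ⟨flipAt k (flipAt i ρ), flip_mem _ (flip_mem ρ (fun _ _ => rfl) i hi) k hk, ?_, ?_⟩
      · simp only [flipAt, Function.update_of_ne hki.symm, Function.update_self]
        revert hc
        cases ρ i <;> cases c <;> simp
      · intro b
        rw [blockSum_flipAt, blockSum_flipAt, hρ, hblk]
        split_ifs <;> decide
  by_cases hlive : D = ∅
  · simp [hlive]
  obtain ⟨i₀, hi₀⟩ := Finset.nonempty_iff_ne_empty.2 hlive
  obtain ⟨k₀, hk₀, hne, -⟩ := partner i₀ hi₀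
  obtain ⟨i, hi, c, C', hC', hcard⟩ := AndCircuit.exists_restrict_three flip_mem
    (fun v hv => ⟨ρ v, fun x hx => hx v hv⟩)
    (fun i hi j hj hij c => by
      obtain ⟨x, hxD, hxj, hx⟩ := even_point j hj c
      refine ⟨x, hxD, hxj, ?_⟩
      rw [(hf x).2 hx]
      intro h
      have := (hf _).1 h (blk i)
      rw [blockSum_flipAt, hx] at this
      simp at this)
    ⟨k₀, hk₀, i₀, hi₀, hne⟩ _ C rfl hC
  obtain ⟨ρ', hρD, hρi, hρ'⟩ := even_point i hi c
  -- Fix `i`, together with the last variable of its block if only two are live.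
  obtain ⟨E, hED, hiE, hcardE, hother⟩ : ∃ E ⊆ D, i ∉ E ∧
      ((E.filter (blk · = blk i)).card ≠ 1 ∧
        (D.filter (blk · = blk i)).card - 1 ≤ (E.filter (blk · = blk i)).card - 1 + 1) ∧
      ∀ b, b ≠ blk i → E.filter (blk · = b) = D.filter (blk · = b) := by
    by_cases htwo : (D.filter (blk · = blk i)).card = 2
    · refine ⟨D.filter (blk · ≠ blk i), Finset.filter_subset _ _, by simp, ?_, ?_⟩
      · rw [Finset.filter_filter, htwo]
        simp
      · intro b hb
        ext v
        simp only [Finset.mem_filter]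
        constructor
        · exact fun h => ⟨h.1.1, h.2⟩
        · exact fun h => ⟨⟨h.1, h.2 ▸ hb⟩, h.2⟩
    · refine ⟨D.erase i, Finset.erase_subset _ _, by simp, ?_, ?_⟩
      · rw [Finset.filter_erase, Finset.card_erase_of_mem (by simp [hi])]
        have := hD (blk i)
        omega
      · intro b hb
        rw [Finset.filter_erase, Finset.erase_eq_of_notMem]
        simp [hb.symm]
  have hrec := ih E (Finset.ssubset_iff_subset_ne.2 ⟨hED, fun e => hiE (e ▸ hi)⟩) ρ' C' hρ'
    (fun b => by
      by_cases hb : b = blk i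
      · rw [hb]
        exact hcardE.1
      · rw [hother b hb]
        exact hD b)
    (hC'.mono fun x hx => ⟨fun v hv => by rw [hx v (fun h => hv (hED h)), hρD v hv],
      by rw [hx i hiE, hρi]⟩)
  have hsum : ∑ b, ((D.filter (blk · = b)).card - 1) ≤
      ∑ b, (((E.filter (blk · = b)).card - 1) + if b = blk i then 1 else 0) := by
    refine Finset.sum_le_sum fun b _ => ?_
    by_cases hb : b = blk i
    · rw [hb]
      simpa using hcardE.2
    · rw [hother b hb]
      simp
  rw [Finset.sum_add_distrib] at hsum
  simp only [Finset.sum_ite_eq', Finset.mem_univ, if_true] at hsum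
  omega

namespace U2Circuit

variable {n : ℕ}

/-- The signal computed by a node; the value of a gate is taken before its output negation. -/
def signal (c : U2Circuit n 0) (i : ℕ) : SignedSignal (Fin n) :=
  match c.nodeAt i with
  | .actual a => ⟨.var a, false⟩
  | .guess _ => ⟨.const false, false⟩
  | .const b => ⟨.const b, false⟩
  | .gate _ _ e _ _ => ⟨.gate i, e⟩

/-- The AND-circuit of a deterministic `U₂`-circuit. -/
def toAndCircuit (c : U2Circuit n 0) : AndCircuit (Fin n) where
  gates := (Finset.univ.filter fun i : Fin c.N => (c.node i).isGate = true).map Fin.valEmbedding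
  pred i s :=
    match c.nodeAt i with
    | .gate a b _ j k =>
      if s then ⟨(c.signal k).src, xor (c.signal k).neg b⟩
      else ⟨(c.signal j).src, xor (c.signal j).neg a⟩
    | _ => ⟨.const false, false⟩
  val i x :=
    match c.nodeAt i with
    | .gate _ _ e _ _ => xor (c.evalAux x Fin.elim0 i) e
    | _ => false
  out := c.signal c.output

theorem card_gates_toAndCircuit (c : U2Circuit n 0) : c.toAndCircuit.gates.card = c.size := by
  simp [toAndCircuit, size]

theorem mem_gates_toAndCircuit (c : U2Circuit n 0) (i : ℕ) :
    i ∈ c.toAndCircuit.gates ↔ ∃ a b e j k, c.nodeAt i = .gate a b e j k := by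
  simp only [toAndCircuit, Finset.mem_map, Finset.mem_filter, Finset.mem_univ, true_and,
    Fin.valEmbedding_apply]
  constructor
  · rintro ⟨i, hi, rfl⟩
    simp only [nodeAt, i.isLt, dif_pos]
    cases h : c.node i <;> simp_all [U2Node.isGate]
  · rintro ⟨a, b, e, j, k, h⟩
    unfold nodeAt at h
    split_ifs at h with hi
    exact ⟨⟨i, hi⟩, by simp [h, U2Node.isGate], rfl⟩

theorem eval_signal (c : U2Circuit n 0) (x : Fin n → Bool) (i : ℕ) :
    (c.signal i).eval c.toAndCircuit.val x = c.evalAux x Fin.elim0 i := by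
  unfold signal
  cases h : c.nodeAt i with
  | actual a => rw [evalAux]; simp [SignedSignal.eval, Signal.eval, h]
  | guess g => exact g.elim0
  | const b => rw [evalAux]; simp [SignedSignal.eval, Signal.eval, h]
  | gate a b e j k => simp [SignedSignal.eval, Signal.eval, toAndCircuit, h]

theorem signal_src (c : U2Circuit n 0) {i j : ℕ} (h : (c.signal i).src = .gate j) :
    j = i ∧ i ∈ c.toAndCircuit.gates := by
  rw [mem_gates_toAndCircuit]
  unfold signal at h
  cases hi : c.nodeAt i <;> simp_all

theorem nodeAt_wf {m : ℕ} (c : U2Circuit n m) {i : ℕ} {a b e : Bool} {j k : ℕ}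
    (h : c.nodeAt i = .gate a b e j k) : j < i ∧ k < i := by
  unfold nodeAt at h
  split_ifs at h with hi
  exact c.wf _ _ _ _ _ _ h

theorem computesOn_toAndCircuit (c : U2Circuit n 0) (f : (Fin n → Bool) → Bool)
    (hc : c.Computes f) : c.toAndCircuit.ComputesOn Set.univ f where
  val_eq i hi x _ := by
    obtain ⟨a, b, e, j, k, h⟩ := (c.mem_gates_toAndCircuit i).1 hi
    obtain ⟨hj, hk⟩ := c.nodeAt_wf h
    have hjv := c.eval_signal x j
    have hkv := c.eval_signal x k
    have hl : (c.toAndCircuit.pred i false) = ⟨(c.signal j).src, xor (c.signal j).neg a⟩ := by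
      simp [toAndCircuit, h]
    have hr : (c.toAndCircuit.pred i true) = ⟨(c.signal k).src, xor (c.signal k).neg b⟩ := by
      simp [toAndCircuit, h]
    have hv : c.toAndCircuit.val i x = xor (c.evalAux x Fin.elim0 i) e := by
      simp [toAndCircuit, h]
    rw [hl, hr, hv, evalAux, h]
    simp only [hj, hk, dif_pos, ← hjv, ← hkv]
    simp [SignedSignal.eval]
  pred_lt i hi s l hl := by
    obtain ⟨a, b, e, j, k, h⟩ := (c.mem_gates_toAndCircuit i).1 hi
    obtain ⟨hj, hk⟩ := c.nodeAt_wf h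
    cases s
    · have hl' : (c.signal j).src = .gate l := by simpa [toAndCircuit, h] using hl
      obtain ⟨rfl, hmem⟩ := c.signal_src hl'
      exact ⟨hmem, hj⟩
    · have hl' : (c.signal k).src = .gate l := by simpa [toAndCircuit, h] using hl
      obtain ⟨rfl, hmem⟩ := c.signal_src hl'
      exact ⟨hmem, hk⟩
  out_mem j hj := by
    obtain ⟨rfl, hmem⟩ := c.signal_src hj
    exact hmem
  out_eq x _ := by
    have hx : f x = true ↔ c.eval x Fin.elim0 = true := by
      rw [hc x]
      exact ⟨fun ⟨y, hy⟩ => by rwa [Subsingleton.elim Fin.elim0 y], fun h => ⟨_, h⟩⟩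
    rw [show c.toAndCircuit.out = c.signal c.output from rfl, eval_signal]
    exact Bool.eq_iff_iff.2 hx

/-! ### Building circuits gate by gate -/

/-- Some circuit with `s` gates has, for every function in `F`, a node computing it. -/
def Provides (n s : ℕ) (F : Set ((Fin n → Bool) → Bool)) : Prop :=
  ∃ c : U2Circuit n 0, c.size = s ∧ ∀ g ∈ F, ∃ i < c.N, ∀ x y, c.evalAux x y i = g x

theorem Provides.mono {s : ℕ} {F G : Set ((Fin n → Bool) → Bool)} (h : Provides n s F)
    (hGF : G ⊆ F) : Provides n s G := by
  obtain ⟨c, hs, hc⟩ := h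
  exact ⟨c, hs, fun g hg => hc g (hGF hg)⟩

theorem provides_inputs (n : ℕ) :
    Provides n 0 (insert (fun _ => false) (Set.range fun (v : Fin n) x => x v)) := by
  let c : U2Circuit n 0 :=
    { N := n + 1
      node := Fin.lastCases (.const false) fun v => .actual v
      output := Fin.last n
      wf := fun i => by
        refine Fin.lastCases ?_ (fun v => ?_) i <;> intros <;> simp_all }
  refine ⟨c, ?_, ?_⟩
  · simp only [size, Finset.card_eq_zero, Finset.filter_eq_empty_iff, Finset.mem_univ, true_imp_iff]
    intro i
    refine Fin.lastCases ?_ (fun v => ?_) i <;> simp [c, U2Node.isGate]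
  · rintro g (rfl | ⟨v, rfl⟩)
    · refine ⟨n, Nat.lt_succ_self n, fun x y => ?_⟩
      have : c.nodeAt n = .const false := by
        have hn : n < n + 1 := Nat.lt_succ_self n
        simp only [nodeAt, c, hn, dif_pos]
        exact Fin.lastCases_last (motive := fun _ => U2Node n 0)
      rw [evalAux, this]
    · refine ⟨v, Nat.lt_succ_of_lt v.isLt, fun x y => ?_⟩
      have : c.nodeAt v = .actual v := by
        have hv : (v : ℕ) < n + 1 := Nat.lt_succ_of_lt v.isLt
        simp only [nodeAt, c, hv, dif_pos]
        exact Fin.lastCases_castSucc (motive := fun _ => U2Node n 0) v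
      rw [evalAux, this]

theorem evalAux_congr {c d : U2Circuit n 0} (i : ℕ) (h : ∀ j ≤ i, c.nodeAt j = d.nodeAt j)
    (x : Fin n → Bool) (y : Fin 0 → Bool) : c.evalAux x y i = d.evalAux x y i := by
  induction i using Nat.strong_induction_on with
  | _ i ih =>
  rw [evalAux, evalAux, h i le_rfl]
  cases hn : d.nodeAt i with
  | gate a b e j k =>
    obtain ⟨hj, hk⟩ := d.nodeAt_wf hn
    simp only [hj, hk, dif_pos]
    rw [ih j hj fun l hl => h l (hl.trans hj.le), ih k hk fun l hl => h l (hl.trans hk.le)]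
  | _ => rfl

theorem Provides.gate {s : ℕ} {F : Set ((Fin n → Bool) → Bool)} (h : Provides n s F)
    {g k : (Fin n → Bool) → Bool} (hg : g ∈ F) (hk : k ∈ F) (a b e : Bool) :
    Provides n (s + 1) (insert (fun x => xor (xor (g x) a && xor (k x) b) e) F) := by
  obtain ⟨c, hs, hc⟩ := h
  obtain ⟨p, hp, hpg⟩ := hc g hg
  obtain ⟨q, hq, hqk⟩ := hc k hk
  let d : U2Circuit n 0 :=
    { N := c.N + 1
      node := Fin.lastCases (.gate a b e p q) c.node
      output := Fin.last c.N
      wf := fun i => by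
        refine Fin.lastCases ?_ (fun v => ?_) i
        · intro a' b' e' j k h
          simp only [Fin.lastCases_last, U2Node.gate.injEq] at h
          obtain ⟨-, -, -, rfl, rfl⟩ := h
          exact ⟨hp, hq⟩
        · intro a' b' e' j k h
          simp only [Fin.lastCases_castSucc] at h
          exact c.wf v _ _ _ _ _ h }
  have hlast : d.nodeAt c.N = .gate a b e p q := by
    have : c.N < c.N + 1 := Nat.lt_succ_self _
    simp only [nodeAt, d, this, dif_pos]
    exact Fin.lastCases_last (motive := fun _ => U2Node n 0)
  have hold : ∀ i < c.N, d.nodeAt i = c.nodeAt i := by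
    intro i hi
    have hi' : i < c.N + 1 := Nat.lt_succ_of_lt hi
    simp only [nodeAt, d, hi, hi', dif_pos]
    exact Fin.lastCases_castSucc (motive := fun _ => U2Node n 0) (⟨i, hi⟩ : Fin c.N)
  have heval : ∀ i < c.N, ∀ x y, d.evalAux x y i = c.evalAux x y i := fun i hi x y =>
    evalAux_congr i (fun j hj => hold j (by omega)) x y
  refine ⟨d, ?_, ?_⟩
  · rw [← hs]
    simp only [size, Finset.card_filter]
    change ∑ i : Fin (c.N + 1), _ = _
    rw [Fin.sum_univ_castSucc]
    simp only [d, Fin.lastCases_castSucc, Fin.lastCases_last]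
    rfl
  · rintro r (rfl | hr)
    · refine ⟨c.N, Nat.lt_succ_self _, fun x y => ?_⟩
      rw [evalAux, hlast]
      simp only [hp, hq, dif_pos, heval p hp, heval q hq, hpg, hqk]
    · obtain ⟨i, hi, hir⟩ := hc r hr
      exact ⟨i, Nat.lt_succ_of_lt hi, fun x y => by rw [heval i hi, hir]⟩

theorem Provides.xor {s : ℕ} {F : Set ((Fin n → Bool) → Bool)} (h : Provides n s F)
    {g k : (Fin n → Bool) → Bool} (hg : g ∈ F) (hk : k ∈ F) :
    Provides n (s + 3) (insert (fun x => xor (g x) (k x)) F) := by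
  have h₁ := h.gate hg hk false false false
  have h₂ := h₁.gate (Set.mem_insert_of_mem _ hg) (Set.mem_insert_of_mem _ hk) true true false
  have h₃ := h₂.gate (Set.mem_insert _ _) (Set.mem_insert_of_mem _ (Set.mem_insert _ _))
    true true false
  refine h₃.mono (Set.insert_subset ?_ ?_)
  · convert Set.mem_insert _ _ using 1
    funext x
    cases g x <;> cases k x <;> rfl
  · exact fun r hr => Set.mem_insert_of_mem _ (Set.mem_insert_of_mem _ (Set.mem_insert_of_mem _ hr))

theorem Provides.or {s : ℕ} {F : Set ((Fin n → Bool) → Bool)} (h : Provides n s F)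
    {g k : (Fin n → Bool) → Bool} (hg : g ∈ F) (hk : k ∈ F) :
    Provides n (s + 1) (insert (fun x => g x || k x) F) := by
  convert h.gate hg hk true true true using 3 with x
  cases g x <;> cases k x <;> rfl

theorem parityFun_succ (k : ℕ) (x : Fin (k + 1) → Bool) :
    parityFun (k + 1) x = Bool.xor (parityFun k fun j => x j.castSucc) (x (Fin.last k)) := by
  simp only [parityFun, Fin.sum_univ_castSucc]
  generalize ∑ i : Fin k, (x i.castSucc).toNat = N
  cases x (Fin.last k)
  · simp
  · rcases Nat.mod_two_eq_zero_or_one N with h | h <;> simp [h, Nat.add_mod]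

theorem Provides.parity {s : ℕ} {F : Set ((Fin n → Bool) → Bool)} (h : Provides n s F) (k : ℕ)
    (e : Fin (k + 1) → Fin n) (he : ∀ j, (fun x => x (e j)) ∈ F) :
    Provides n (s + 3 * k) (insert (fun x => parityFun (k + 1) fun j => x (e j)) F) := by
  induction k with
  | zero =>
    refine h.mono (Set.insert_subset ?_ subset_rfl)
    convert he 0 using 1
    funext x
    cases hx : x (e 0) <;> simp [parityFun, hx]
  | succ k ih =>
    have h₁ := (ih (fun j => e j.castSucc) fun j => he _).xor (Set.mem_insert _ _)
      (Set.mem_insert_of_mem _ (he (Fin.last (k + 1))))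
    refine (show s + 3 * k + 3 = s + 3 * (k + 1) by ring) ▸ h₁.mono (Set.insert_subset ?_ ?_)
    · convert Set.mem_insert _ _ using 1
      funext x
      exact parityFun_succ (k + 1) _
    · exact fun r hr => Set.mem_insert_of_mem _ (Set.mem_insert_of_mem _ hr)

theorem Provides.exists_computes {s : ℕ} {F : Set ((Fin n → Bool) → Bool)} (h : Provides n s F)
    {f : (Fin n → Bool) → Bool} (hf : f ∈ F) : ∃ c : U2Circuit n 0, c.Computes f ∧ c.size = s := by
  obtain ⟨c, hs, hc⟩ := h
  obtain ⟨i, hi, hif⟩ := hc f hf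
  let d : U2Circuit n 0 := { c with output := ⟨i, hi⟩ }
  refine ⟨d, fun x => ?_, hs⟩
  have hd : ∀ y, d.eval x y = f x := fun y =>
    (evalAux_congr (c := d) (d := c) i (fun _ _ => rfl) x y).trans (hif x y)
  simp only [hd]
  exact ⟨fun hx => ⟨Fin.elim0, hx⟩, fun ⟨_, hx⟩ => hx⟩

end U2Circuit

theorem exists_computes_blockParityOr (m : ℕ) :
    ∃ c : U2Circuit (m * m) 0, c.Computes (blockParityOr m) ∧ c.size ≤ 3 * (m * m) := by
  have hmain : ∀ t (ht : t ≤ m), U2Circuit.Provides (m * m) (t * (3 * (m - 1) + 1))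
      (insert (fun x => decide (∃ i : Fin m, (i : ℕ) < t ∧
        parityFun m (fun j => x ⟨m * (i : ℕ) + (j : ℕ), blockIdx_lt i j⟩) = true))
        (Set.range fun (v : Fin (m * m)) x => x v)) := by
    intro t
    induction t with
    | zero => simpa using U2Circuit.provides_inputs (m * m)
    | succ t ih =>
      intro ht
      have hprev := ih (by omega)
      obtain ⟨k, rfl⟩ : ∃ k, m = k + 1 := ⟨m - 1, by omega⟩
      have hpar := hprev.parity k
        (fun j => ⟨(k + 1) * t + (j : ℕ), blockIdx_lt (⟨t, ht⟩ : Fin (k + 1)) j⟩)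
        (fun j => Set.mem_insert_of_mem _ ⟨_, rfl⟩)
      have hor := hpar.or (Set.mem_insert_of_mem _ (Set.mem_insert _ _)) (Set.mem_insert _ _)
      have hcount : t * (3 * (k + 1 - 1) + 1) + 3 * k + 1 = (t + 1) * (3 * (k + 1 - 1) + 1) := by
        rw [Nat.add_sub_cancel]
        ring
      rw [hcount] at hor
      refine hor.mono (Set.insert_subset ?_ ?_)
      · convert Set.mem_insert _ _ using 1
        funext x
        rw [Bool.eq_iff_iff]
        simp only [decide_eq_true_eq, Bool.or_eq_true]
        constructor
        · rintro ⟨i, hi, hx⟩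
          rcases Nat.lt_succ_iff_lt_or_eq.1 hi with h | h
          · exact Or.inl ⟨i, h, hx⟩
          · subst h
            exact Or.inr hx
        · rintro (⟨i, hi, hx⟩ | hx)
          · exact ⟨i, by omega, hx⟩
          · exact ⟨⟨t, ht⟩, Nat.lt_succ_self t, hx⟩
      · exact fun r hr =>
          Set.mem_insert_of_mem _ (Set.mem_insert_of_mem _ (Set.mem_insert_of_mem _ hr))
  obtain ⟨c, hc, hs⟩ := ((hmain m le_rfl).exists_computes (f := blockParityOr m) (by
    convert Set.mem_insert _ _ using 1
    funext x
    simp [blockParityOr]))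
  refine ⟨c, hc, ?_⟩
  rw [hs, Nat.mul_left_comm]
  rcases m with _ | m
  · simp
  · exact Nat.mul_le_mul_left _ (by omega)

theorem sizeDC_blockParityOr_le (m : ℕ) : sizeDC (blockParityOr m) ≤ 3 * (m * m) := by
  obtain ⟨c, hc, hs⟩ := exists_computes_blockParityOr m
  have hle : sizeDC (blockParityOr m) ≤ c.size := Nat.sInf_le ⟨c, hc, rfl⟩
  exact hle.trans hs

theorem blockParityOr_eq_false_iff (m : ℕ) (x : Fin (m * m) → Bool) :
    blockParityOr m x = false ↔
      ∀ b, blockSum (fun v : Fin (m * m) => (finProdFinEquiv.symm v).1) b x = 0 := by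
  have hsum : ∀ b : Fin m, blockSum (fun v : Fin (m * m) => (finProdFinEquiv.symm v).1) b x =
      ((∑ j : Fin m, (x ⟨m * (b : ℕ) + (j : ℕ), blockIdx_lt b j⟩).toNat : ℕ) : ZMod 2) := by
    intro b
    rw [blockSum, ← Equiv.sum_comp finProdFinEquiv, Fintype.sum_prod_type,
      Finset.sum_eq_single b]
    · push_cast
      refine Finset.sum_congr rfl fun j _ => ?_
      have : finProdFinEquiv (b, j) = ⟨m * (b : ℕ) + (j : ℕ), blockIdx_lt b j⟩ := by
        ext
        simp [finProdFinEquiv, Nat.add_comm]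
      rw [this, ← this]
      cases x (finProdFinEquiv (b, j)) <;> simp
    · intro b' _ hb'
      simp [hb']
    · simp
  simp only [blockParityOr, parityFun, decide_eq_false_iff_not, decide_eq_true_eq, not_exists, hsum,
    ZMod.natCast_eq_zero_iff_even, Nat.even_iff, Nat.mod_two_ne_one]

theorem le_sizeDC_blockParityOr (m : ℕ) : 3 * (m * (m - 1)) ≤ sizeDC (blockParityOr m) := by
  have hmem := Nat.sInf_mem (s := {s | ∃ c : U2Circuit (m * m) 0,
    c.Computes (blockParityOr m) ∧ c.size = s}) (by
      obtain ⟨c, hc, -⟩ := exists_computes_blockParityOr m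
      exact ⟨_, c, hc, rfl⟩)
  obtain ⟨c, hc, hs⟩ := hmem
  rw [sizeDC, ← hs, ← c.card_gates_toAndCircuit]
  by_cases hm : m = 1
  · simp [hm]
  have hcard : ∀ b : Fin m, ((Finset.univ : Finset (Fin (m * m))).filter
      ((fun v => (finProdFinEquiv.symm v).1) · = b)).card = m := by
    intro b
    rw [Finset.card_filter, ← Equiv.sum_comp finProdFinEquiv, Fintype.sum_prod_type]
    simp
  have := three_mul_sum_le_card_gates _ (blockParityOr m) (blockParityOr_eq_false_iff m)
    Finset.univ (fun _ => false) c.toAndCircuit (fun b => by simp [blockSum])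
    (fun b => by rw [hcard b]; exact hm)
    ((c.computesOn_toAndCircuit _ hc).mono (Set.subset_univ _))
  simpa only [hcard, Finset.sum_const, Finset.card_univ, Fintype.card_fin, smul_eq_mul] using this

/-- For `n = m²`, the disjunction of the parities of the `m`
consecutive blocks of `m` variables has deterministic `U₂`-circuit complexity
`3n − o(n)`: there is `h(n) = o(n)` such that
`3n − h(n) ≤ size^dc(f_n) ≤ 3n` for all perfect squares `n = m²`. -/
theorem sizeDC_blockParityOr :
    ∃ h : ℕ → ℝ,
      Filter.Tendsto (fun n : ℕ => h n / (n : ℝ)) Filter.atTop (nhds 0) ∧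
      ∀ m : ℕ,
        3 * ((m * m : ℕ) : ℝ) - h (m * m) ≤ (sizeDC (blockParityOr m) : ℝ) ∧
        (sizeDC (blockParityOr m) : ℝ) ≤ 3 * ((m * m : ℕ) : ℝ) := by
  refine ⟨fun n => 3 * √(n : ℝ), ?_, fun m => ⟨?_, ?_⟩⟩
  · have hinv : Filter.Tendsto (fun n : ℕ => 3 * (√(n : ℝ))⁻¹) Filter.atTop (nhds (3 * 0)) :=
      ((tendsto_inv_atTop_zero.comp Real.tendsto_sqrt_atTop).comp
        tendsto_natCast_atTop_atTop).const_mul 3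
    rw [mul_zero] at hinv
    refine hinv.congr fun n => ?_
    rw [mul_div_assoc, Real.sqrt_div_self]
  · have hle : (3 * (m * (m - 1) : ℕ) : ℝ) ≤ (sizeDC (blockParityOr m) : ℝ) := by
      exact_mod_cast le_sizeDC_blockParityOr m
    refine le_trans (le_of_eq ?_) hle
    push_cast
    rw [Real.sqrt_mul_self (Nat.cast_nonneg m)]
    rcases m with _ | m
    · simp
    · push_cast [Nat.add_sub_cancel]
      ring
  · exact_mod_cast sizeDC_blockParityOr_le m
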